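/- For all positive integers n, p, k with 1 ≤ p ≤ n, the generalized q-binomial coefficient admits the expression (n choose p,k)_q = ([n]_q/[p]_q) · Σ_{i=0}^{k-1} [n-p choose k-1-i]_q [n-p+i choose i]_q [p choose i+1]_q q^{(i+1)(i+1-k) + (n-p)p}, where (n choose p,k)_q = ([n]_q/[k]_q) · Σ_{r≥0} [p choose r]_q [n-p choose r]_q [n-r-1 choose k-r-1]_q q^{(n-p)p + r(r-k)}. -/

import Mathlib

open Finset

/-- The variable `q`, as a rational function over `ℚ`. -/
noncomputable def q : RatFunc ℚ := RatFunc.X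

/-- The q-integer `[m]_q = (1 - q^m)/(1 - q)`. -/
noncomputable def qint (m : ℕ) : RatFunc ℚ := (1 - q ^ m) / (1 - q)

/-- The q-integer for an integer exponent, `[x; q] = (q^x - 1)/(q - 1)`. -/
noncomputable def qintZ (x : ℤ) : RatFunc ℚ := (q ^ x - 1) / (q - 1)

/-- The q-factorial `[m]!_q`. -/
noncomputable def qfac (m : ℕ) : RatFunc ℚ := ∏ i ∈ Finset.range m, qint (i + 1)

/-- The Gaussian q-binomial coefficient `[a choose b]_q`, zero when `b < 0` or `b > a`. -/
noncomputable def qbin (a b : ℤ) : RatFunc ℚ :=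
  if 0 ≤ b ∧ b ≤ a then qfac a.toNat / (qfac b.toNat * qfac (a - b).toNat) else 0

/-- The first generalized q-binomial coefficient `(n choose p, k)_q`:
`([n]_q/[k]_q) · Σ_{r≥0} [p choose r]_q [n-p choose r]_q [n-r-1 choose k-r-1]_q
  q^{(n-p)p + r(r-k)}`. -/
noncomputable def gchoose (n p k : ℕ) : RatFunc ℚ :=
  (qint n / qint k) *
    ∑ r ∈ Finset.range (n + 1),
      qbin p r * qbin ((n : ℤ) - p) r * qbin ((n : ℤ) - r - 1) ((k : ℤ) - r - 1) *
        q ^ (((n : ℤ) - p) * p + (r : ℤ) * ((r : ℤ) - k))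

theorem q_ne_zero : q ≠ 0 := RatFunc.X_ne_zero

theorem q_pow_ne_one (m : ℕ) : q ^ (m + 1) ≠ 1 := by
  intro h
  unfold q at h
  rw [← RatFunc.algebraMap_X, ← map_pow, ← map_one (algebraMap (Polynomial ℚ) (RatFunc ℚ))] at h
  have h2 := RatFunc.algebraMap_injective ℚ h
  have h3 := congrArg Polynomial.natDegree h2
  simp at h3

theorem q_sub_ne : (1 : RatFunc ℚ) - q ≠ 0 := by
  have := q_pow_ne_one 0
  intro h
  apply this
  rw [zero_add, pow_one]
  exact (sub_eq_zero.mp h).symm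

theorem q_sub_ne' : q - 1 ≠ 0 := by
  intro h
  apply q_sub_ne
  rw [← neg_sub, h, neg_zero]

theorem qint_ne (m : ℕ) : qint (m + 1) ≠ 0 := by
  unfold qint
  refine div_ne_zero ?_ q_sub_ne
  intro h
  exact q_pow_ne_one m (sub_eq_zero.mp h).symm

theorem qint_eq (m : ℕ) : qint m = qintZ m := by
  unfold qint qintZ
  rw [zpow_natCast, ← neg_sub, ← neg_sub q 1, neg_div_neg_eq]

theorem qintZ_zero : qintZ 0 = 0 := by simp [qintZ]

theorem qintZ_add (a b : ℤ) : qintZ (a + b) = qintZ a + q ^ a * qintZ b := by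
  unfold qintZ
  rw [zpow_add₀ q_ne_zero]
  have := q_sub_ne'
  field_simp
  ring

theorem qfac_ne (m : ℕ) : qfac m ≠ 0 := by
  unfold qfac
  exact Finset.prod_ne_zero_iff.mpr fun i _ => qint_ne i

theorem qfac_succ (m : ℕ) : qfac (m + 1) = qfac m * qint (m + 1) := by
  unfold qfac
  rw [Finset.prod_range_succ]

theorem qbin_nat (b d : ℕ) : qbin ((b : ℤ) + d) b = qfac (b + d) / (qfac b * qfac d) := by
  unfold qbin
  rw [if_pos (by omega)]
  have h1 : ((b : ℤ) + d).toNat = b + d := by omega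
  have h2 : ((b : ℤ) + d - b).toNat = d := by omega
  rw [h1, h2, Int.toNat_natCast]

theorem qbin_neg (a b : ℤ) (h : b < 0) : qbin a b = 0 := by
  unfold qbin
  rw [if_neg (by omega)]

theorem qbin_gt (a b : ℤ) (h : a < b) : qbin a b = 0 := by
  unfold qbin
  rw [if_neg (by omega)]

theorem qbin_zero (a : ℕ) : qbin a 0 = 1 := by
  have := qbin_nat 0 a
  simp only [Nat.cast_zero, zero_add] at this
  rw [this]
  have := qfac_ne a
  simp [qfac]
  simpa [qfac] using this

theorem qbin_symm (a b : ℤ) : qbin a (a - b) = qbin a b := by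
  unfold qbin
  by_cases h : 0 ≤ b ∧ b ≤ a
  · rw [if_pos h, if_pos (by omega)]
    rw [sub_sub_cancel, mul_comm (qfac b.toNat)]
  · rw [if_neg h, if_neg (by omega)]

theorem absorb (a : ℕ) (b : ℤ) :
    qintZ b * qbin ((a : ℤ) + 1) b = qintZ ((a : ℤ) + 1) * qbin a (b - 1) := by
  by_cases h : 1 ≤ b ∧ b ≤ a + 1
  · obtain ⟨j, rfl⟩ : ∃ j : ℕ, b = j + 1 := ⟨(b - 1).toNat, by omega⟩
    obtain ⟨d, rfl⟩ : ∃ d : ℕ, a = j + d := ⟨a - j, by omega⟩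
    have e1 := qbin_nat (j + 1) d
    have e2 := qbin_nat j d
    have e3 : j + 1 + d = (j + d) + 1 := by ring
    rw [e3, qfac_succ, qfac_succ] at e1
    have e4 : (((j + d : ℕ) : ℤ) + 1) = ((j + 1 : ℕ) : ℤ) + d := by push_cast; ring
    have e5 : ((j : ℤ) + 1) = ((j + 1 : ℕ) : ℤ) := by push_cast; ring
    have e6 : (((j + d : ℕ) : ℤ)) = (j : ℤ) + d := by push_cast; ring
    have e7 : ((j + 1 : ℕ) : ℤ) - 1 = j := by push_cast; ring
    have e8 : ((j + 1 : ℕ) : ℤ) + d = ((j + d + 1 : ℕ) : ℤ) := by push_cast; ring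
    rw [e4, e5, e1, e6, e7, e2, e8, ← qint_eq, ← qint_eq]
    have := qint_ne j
    have := qfac_ne j
    have := qfac_ne d
    field_simp
  · rcases lt_trichotomy b 0 with hb | hb | hb
    · rw [qbin_neg _ _ hb, qbin_neg _ _ (by omega)]; simp
    · subst hb
      rw [qintZ_zero, qbin_neg _ (0 - 1) (by omega)]; simp
    · rw [qbin_gt _ _ (by omega), qbin_gt _ _ (by omega)]; simp

theorem absorb' (a : ℕ) (b : ℤ) :
    qintZ ((a : ℤ) + 1 - b) * qbin ((a : ℤ) + 1) b = qintZ ((a : ℤ) + 1) * qbin a b := by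
  have h := absorb a ((a : ℤ) + 1 - b)
  rw [qbin_symm] at h
  rw [h, show (a : ℤ) + 1 - b - 1 = a - b by ring, qbin_symm]

theorem qintZ_ne (a : ℕ) : qintZ ((a : ℤ) + 1) ≠ 0 := by
  have h := qint_ne a
  rw [qint_eq] at h
  exact_mod_cast h

theorem pascal (a : ℕ) (b : ℤ) :
    qbin ((a : ℤ) + 1) b = qbin a (b - 1) + q ^ b * qbin a b := by
  apply mul_left_cancel₀ (qintZ_ne a)
  have h := qintZ_add b ((a : ℤ) + 1 - b)
  rw [add_sub_cancel] at h
  have h1 := absorb a b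
  have h2 := absorb' a b
  rw [mul_add, ← h1, mul_left_comm, ← h2, h]
  ring

theorem pascal' (a : ℕ) (b : ℤ) :
    qbin ((a : ℤ) + 1) b = qbin a b + q ^ ((a : ℤ) + 1 - b) * qbin a (b - 1) := by
  apply mul_left_cancel₀ (qintZ_ne a)
  have h := qintZ_add ((a : ℤ) + 1 - b) b
  rw [sub_add_cancel] at h
  have h1 := absorb a b
  have h2 := absorb' a b
  rw [mul_add, ← h2, mul_left_comm, ← h1, h]
  ring

theorem vand (a : ℕ) : ∀ (b : ℕ) (c : ℤ), qbin ((a : ℤ) + b) c =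
    ∑ s ∈ Finset.range (a + 1), qbin a s * qbin b (c - s) * q ^ ((s : ℤ) * (b - c + s)) := by
  induction a with
  | zero =>
    intro b c
    have := qbin_zero 0
    simp only [Nat.cast_zero] at this
    simp [this]
  | succ a ih =>
    intro b c
    have h0 := ih (b + 1) c
    rw [show ((a + 1 : ℕ) : ℤ) + b = (a : ℤ) + ((b + 1 : ℕ) : ℤ) by push_cast; ring, h0]
    have e : ∀ s : ℕ, qbin ((a + 1 : ℕ) : ℤ) s * qbin b (c - s) * q ^ ((s : ℤ) * (b - c + s))
        = qbin a ((s : ℤ) - 1) * qbin b (c - s) * q ^ ((s : ℤ) * (b - c + s))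
         + qbin a s * qbin b (c - s) * q ^ ((s : ℤ) * (b + 1 - c + s)) := by
      intro s
      rw [show ((a + 1 : ℕ) : ℤ) = (a : ℤ) + 1 by push_cast; ring, pascal,
        show (s : ℤ) * (b + 1 - c + s) = s + s * (b - c + s) by ring, zpow_add₀ q_ne_zero]
      ring
    rw [Finset.sum_congr rfl fun s _ => e s, Finset.sum_add_distrib,
      Finset.sum_range_succ' _ (a + 1),
      Finset.sum_range_succ (fun s : ℕ => qbin a s * qbin b (c - s) * q ^ ((s : ℤ) * (b + 1 - c + s))) (a + 1),
      qbin_gt a ((a + 1 : ℕ) : ℤ) (by push_cast; omega), qbin_neg a (((0 : ℕ) : ℤ) - 1) (by norm_num)]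
    simp only [zero_mul, add_zero]
    rw [← Finset.sum_add_distrib]
    refine Finset.sum_congr rfl fun s _ => ?_
    have e1 : ((s + 1 : ℕ) : ℤ) * (b - c + ((s + 1 : ℕ) : ℤ))
        = s * (b + 1 - c + s) + (b + 1 - (c - s)) := by push_cast; ring
    rw [e1, zpow_add₀ q_ne_zero]
    push_cast
    rw [pascal', show (c : ℤ) - (s + 1) = c - s - 1 by ring, add_sub_cancel_right]
    ring

theorem trinom (r d s : ℕ) : qbin ((r : ℤ) + d) r * qbin d s =
    qbin ((r : ℤ) + d) ((r : ℤ) + s) * qbin ((r : ℤ) + s) r := by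
  by_cases h : s ≤ d
  · obtain ⟨e, rfl⟩ := Nat.exists_eq_add_of_le h
    have h1 := qbin_nat r (s + e)
    have h2 := qbin_nat s e
    have h3 := qbin_nat (r + s) e
    have h4 := qbin_nat r s
    rw [← add_assoc] at h1
    push_cast at *
    rw [← add_assoc] at *
    rw [h1, h2, h3, h4]
    have := qfac_ne r
    have := qfac_ne s
    have := qfac_ne e
    have := qfac_ne (r + s)
    have := qfac_ne (s + e)
    field_simp
  · rw [qbin_gt d s (by omega), qbin_gt _ ((r : ℤ) + s) (by omega)]; simp

theorem step1 (p M r : ℕ) (c : ℤ) :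
    qbin p r * qbin ((p : ℤ) - r + M) (c - r) =
      ∑ t ∈ Finset.range (p + 1), qbin p t * qbin t r * qbin M (c - t) *
        q ^ (((t : ℤ) - r) * (M - c + t)) := by
  by_cases h : r ≤ p
  · obtain ⟨d, rfl⟩ := Nat.exists_eq_add_of_le h
    rw [add_assoc, Finset.sum_range_add, Finset.sum_eq_zero (s := Finset.range r), zero_add]
    · rw [show ((r + d : ℕ) : ℤ) - r + M = (d : ℤ) + M by push_cast; ring, vand, Finset.mul_sum]
      refine Finset.sum_congr rfl fun s _ => ?_
      have := trinom r d s
      push_cast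
      rw [← this, show c - (r : ℤ) - s = c - (r + s) by ring,
        show (r : ℤ) + s - r = s by ring,
        show (s : ℤ) * (M - (c - r) + s) = s * (M - c + (r + s)) by ring]
      ring
    · intro t ht
      rw [Finset.mem_range] at ht
      rw [qbin_gt t r (by omega)]; simp
  · rw [qbin_gt p r (by omega), zero_mul, eq_comm]
    refine Finset.sum_eq_zero fun t ht => ?_
    rw [Finset.mem_range] at ht
    rw [qbin_gt t r (by omega)]; simp

theorem step2 (m t N : ℕ) (h : t ≤ N) :
    ∑ r ∈ Finset.range (N + 1), qbin t r * qbin m r * q ^ (((t : ℤ) - r) * (m - r)) =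
      qbin ((m : ℤ) + t) t := by
  rw [add_comm (m : ℤ), vand, ← Finset.sum_range_reflect _ (t + 1)]
  rw [← Finset.sum_subset (Finset.range_mono (show t + 1 ≤ N + 1 by omega))]
  · refine Finset.sum_congr rfl fun s hs => ?_
    rw [Finset.mem_range] at hs
    rw [show ((t + 1 - 1 - s : ℕ) : ℤ) = (t : ℤ) - s by omega, qbin_symm,
      show (t : ℤ) - (t - s) = s by ring,
      show (m : ℤ) - t + (t - s) = m - s by ring]
  · intro r _ hr
    rw [Finset.mem_range] at hr
    rw [qbin_gt t r (by omega)]; simp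

theorem step3 (p M k N : ℕ) (h : p ≤ N) :
    ∑ r ∈ Finset.range (N + 1), qbin p r * qbin ((M : ℤ) + 1) r *
      qbin ((p : ℤ) - r + M) ((k : ℤ) - 1 - r) * q ^ ((r : ℤ) * (r - k)) =
    ∑ t ∈ Finset.range (p + 1), qbin p t * qbin M ((k : ℤ) - 1 - t) *
      qbin ((M : ℤ) + 1 + t) t * q ^ ((t : ℤ) * (t - k)) := by
  have e : ∀ r : ℕ, qbin p r * qbin ((M : ℤ) + 1) r *
      qbin ((p : ℤ) - r + M) ((k : ℤ) - 1 - r) * q ^ ((r : ℤ) * (r - k)) =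
      ∑ t ∈ Finset.range (p + 1), qbin p t * qbin M ((k : ℤ) - 1 - t) * q ^ ((t : ℤ) * (t - k)) *
        (qbin t r * qbin ((M + 1 : ℕ) : ℤ) r * q ^ (((t : ℤ) - r) * (((M + 1 : ℕ) : ℤ) - r))) := by
    intro r
    rw [mul_right_comm (qbin (p : ℤ) r), step1, mul_assoc, Finset.sum_mul]
    refine Finset.sum_congr rfl fun t _ => ?_
    have e1 : q ^ (((t : ℤ) - r) * (M - (k - 1) + t)) * q ^ ((r : ℤ) * (r - k)) =
        q ^ ((t : ℤ) * (t - k)) * q ^ (((t : ℤ) - r) * (((M + 1 : ℕ) : ℤ) - r)) := by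
      rw [← zpow_add₀ q_ne_zero, ← zpow_add₀ q_ne_zero]
      congr 1
      push_cast
      ring
    push_cast at e1 ⊢
    linear_combination (qbin p t * qbin t r * qbin M ((k : ℤ) - 1 - t) * qbin ((M : ℤ) + 1) r) * e1
  rw [Finset.sum_congr rfl fun r _ => e r, Finset.sum_comm]
  refine Finset.sum_congr rfl fun t ht => ?_
  rw [Finset.mem_range] at ht
  rw [← Finset.mul_sum, step2 _ _ _ (by omega)]
  push_cast
  ring

/-- coefficient identity -/
theorem coef (M i k : ℕ) :
    qintZ ((M : ℤ) + 1 + (i + 1)) * qbin M ((k : ℤ) - 1 - (i + 1)) +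
      q ^ ((k : ℤ) - (i + 1)) * qintZ ((i : ℤ) + 1) * qbin M ((k : ℤ) - 1 - i) =
    qintZ k * qbin ((M : ℤ) + 1) ((k : ℤ) - 1 - i) := by
  have h1 := absorb M ((k : ℤ) - 1 - i)
  have h2 := pascal M ((k : ℤ) - 1 - i)
  have h3 := qintZ_add ((i : ℤ) + 1) ((M : ℤ) + 1)
  have h4 := qintZ_add ((i : ℤ) + 1) ((k : ℤ) - 1 - i)
  rw [show (i : ℤ) + 1 + ((k : ℤ) - 1 - i) = k by ring] at h4
  rw [add_comm ((M : ℤ) + 1), h3, h4, show (k : ℤ) - 1 - (i + 1) = k - 1 - i - 1 by ring,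
    show (k : ℤ) - (i + 1) = k - 1 - i by ring]
  linear_combination (-q ^ ((i : ℤ) + 1)) * h1 - qintZ ((i : ℤ) + 1) * h2

theorem pmul (p t : ℕ) : qintZ p * qbin p t =
    qintZ t * qbin p t + q ^ (t : ℤ) * qintZ ((t : ℤ) + 1) * qbin p ((t : ℤ) + 1) := by
  have h := qintZ_add t ((p : ℤ) - t)
  rw [add_sub_cancel] at h
  have h2 : qintZ ((p : ℤ) - t) * qbin p t = qintZ ((t : ℤ) + 1) * qbin p ((t : ℤ) + 1) := by
    rcases p with _ | a
    · rw [qbin_gt _ ((t : ℤ) + 1) (by push_cast; omega)]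
      rcases t with _ | t
      · simp [qintZ_zero]
      · rw [qbin_gt _ _ (by push_cast; omega)]; simp
    · have h3 := absorb a ((t : ℤ) + 1)
      have h4 := absorb' a t
      rw [add_sub_cancel_right] at h3
      push_cast
      rw [h3, h4]
  rw [h]
  linear_combination q ^ (t : ℤ) * h2

theorem step4 (p M k : ℕ) :
    qintZ p * ∑ t ∈ Finset.range (p + 1), qbin p t * qbin M ((k : ℤ) - 1 - t) *
      qbin ((M : ℤ) + 1 + t) t * q ^ ((t : ℤ) * (t - k)) =
    qintZ k * ∑ i ∈ Finset.range p, qbin ((M : ℤ) + 1) ((k : ℤ) - 1 - i) *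
      qbin ((M : ℤ) + 1 + i) i * qbin p ((i : ℤ) + 1) * q ^ (((i : ℤ) + 1) * (i + 1 - k)) := by
  have e : ∀ t : ℕ, qintZ p * (qbin p t * qbin M ((k : ℤ) - 1 - t) *
      qbin ((M : ℤ) + 1 + t) t * q ^ ((t : ℤ) * (t - k))) =
      qintZ t * qbin p t * qbin M ((k : ℤ) - 1 - t) *
      qbin ((M : ℤ) + 1 + t) t * q ^ ((t : ℤ) * (t - k)) +
      q ^ (t : ℤ) * qintZ ((t : ℤ) + 1) * qbin p ((t : ℤ) + 1) * qbin M ((k : ℤ) - 1 - t) *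
      qbin ((M : ℤ) + 1 + t) t * q ^ ((t : ℤ) * (t - k)) := by
    intro t
    linear_combination (qbin M ((k : ℤ) - 1 - t) *
      qbin ((M : ℤ) + 1 + t) t * q ^ ((t : ℤ) * (t - k))) * pmul p t
  rw [Finset.mul_sum, Finset.sum_congr rfl fun t _ => e t, Finset.sum_add_distrib,
    Finset.sum_range_succ', Finset.sum_range_succ _ p, qbin_gt p ((p : ℤ) + 1) (by omega),
    Nat.cast_zero, qintZ_zero]
  simp only [mul_zero, zero_mul, add_zero]
  rw [← Finset.sum_add_distrib, Finset.mul_sum]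
  refine Finset.sum_congr rfl fun i _ => ?_
  have h1 := coef M i k
  have h2 := absorb (M + 1 + i) ((i : ℤ) + 1)
  rw [add_sub_cancel_right] at h2
  have h3 : q ^ (i : ℤ) * q ^ ((i : ℤ) * (i - k)) =
      q ^ ((k : ℤ) - (i + 1)) * q ^ (((i : ℤ) + 1) * (i + 1 - k)) := by
    rw [← zpow_add₀ q_ne_zero, ← zpow_add₀ q_ne_zero]
    congr 1
    ring
  push_cast at *
  rw [add_assoc ((M : ℤ) + 1) (i : ℤ) 1] at h2
  linear_combination (qbin p ((i : ℤ) + 1) * qbin M ((k : ℤ) - 1 - (i + 1)) *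
      q ^ (((i : ℤ) + 1) * (i + 1 - k))) * h2 +
    (qintZ ((i : ℤ) + 1) * qbin p ((i : ℤ) + 1) * qbin M ((k : ℤ) - 1 - i) *
      qbin ((M : ℤ) + 1 + i) i) * h3 +
    (qbin ((M : ℤ) + 1 + i) i * qbin p ((i : ℤ) + 1) * q ^ (((i : ℤ) + 1) * (i + 1 - k))) * h1

theorem core (p m k : ℕ) (hp : 1 ≤ p) (hk : 0 < k) :
    qintZ p * ∑ r ∈ Finset.range (p + m + 1), qbin p r * qbin m r *
      qbin ((p : ℤ) + m - r - 1) ((k : ℤ) - r - 1) * q ^ ((r : ℤ) * (r - k)) =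
    qintZ k * ∑ i ∈ Finset.range k, qbin m ((k : ℤ) - 1 - i) *
      qbin ((m : ℤ) + i) i * qbin p ((i : ℤ) + 1) * q ^ (((i : ℤ) + 1) * (i + 1 - k)) := by
  rcases m with _ | M
  · rw [Finset.sum_range_succ', Finset.sum_eq_zero, zero_add]
    · obtain ⟨j, rfl⟩ : ∃ j, k = j + 1 := ⟨k - 1, by omega⟩
      obtain ⟨a, rfl⟩ : ∃ a, p = a + 1 := ⟨p - 1, by omega⟩
      rw [Finset.sum_range_succ, Finset.sum_eq_zero, zero_add]
      · have h := absorb a ((j : ℤ) + 1)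
        have h0 := qbin_zero 0
        have h1 := qbin_zero (a + 1)
        have h2 := qbin_nat j 0
        have h3 : qbin (j : ℤ) j = 1 := by
          rw [← qbin_symm, sub_self, qbin_zero]
        push_cast at *
        rw [show (j : ℤ) + 1 - 1 - j = 0 by ring]
        simp only [zero_add, add_zero, sub_zero, add_sub_cancel_right, h0, h1, h3, zero_mul,
          zpow_zero, mul_one, one_mul, sub_self, mul_zero] at *
        exact h.symm
      · intro i hi
        rw [Finset.mem_range] at hi
        rw [qbin_gt _ _ (by push_cast; omega)]; simp
    · intro r _
      rw [qbin_gt ((0 : ℕ) : ℤ) _ (by push_cast; omega)]; simp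
  · have h3 := step3 p M k (p + (M + 1)) (by omega)
    have h4 := step4 p M k
    rw [← h3] at h4
    have h5 : ∀ N, p ≤ N → ∑ i ∈ Finset.range p, qbin ((M : ℤ) + 1) ((k : ℤ) - 1 - i) *
      qbin ((M : ℤ) + 1 + i) i * qbin p ((i : ℤ) + 1) * q ^ (((i : ℤ) + 1) * (i + 1 - k)) =
      ∑ i ∈ Finset.range N, qbin ((M : ℤ) + 1) ((k : ℤ) - 1 - i) *
      qbin ((M : ℤ) + 1 + i) i * qbin p ((i : ℤ) + 1) * q ^ (((i : ℤ) + 1) * (i + 1 - k)) := by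
      intro N hN
      refine Finset.sum_subset (Finset.range_mono hN) fun i _ hi => ?_
      rw [Finset.mem_range] at hi
      rw [qbin_gt p _ (by omega)]; simp
    have h6 : ∀ N, k ≤ N → ∑ i ∈ Finset.range k, qbin ((M : ℤ) + 1) ((k : ℤ) - 1 - i) *
      qbin ((M : ℤ) + 1 + i) i * qbin p ((i : ℤ) + 1) * q ^ (((i : ℤ) + 1) * (i + 1 - k)) =
      ∑ i ∈ Finset.range N, qbin ((M : ℤ) + 1) ((k : ℤ) - 1 - i) *
      qbin ((M : ℤ) + 1 + i) i * qbin p ((i : ℤ) + 1) * q ^ (((i : ℤ) + 1) * (i + 1 - k)) := by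
      intro N hN
      refine Finset.sum_subset (Finset.range_mono hN) fun i _ hi => ?_
      rw [Finset.mem_range] at hi
      rw [qbin_neg _ ((k : ℤ) - 1 - i) (by omega)]; simp
    rw [h5 (p + k) (by omega), ← h6 (p + k) (by omega)] at h4
    push_cast
    rw [← h4]
    congr 1
    refine Finset.sum_congr rfl fun r _ => ?_
    rw [show (p : ℤ) + (M + 1) - r - 1 = p - r + M by ring,
      show (k : ℤ) - r - 1 = k - 1 - r by ring]

theorem gchoose_corollary (n p k : ℕ) (hp : 1 ≤ p) (hpn : p ≤ n) (hk : 0 < k) :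
    gchoose n p k =
      (qint n / qint p) *
        ∑ i ∈ Finset.range k,
          qbin ((n : ℤ) - p) ((k : ℤ) - 1 - i) * qbin ((n : ℤ) - p + i) i *
            qbin p ((i : ℤ) + 1) *
            q ^ (((i : ℤ) + 1) * ((i : ℤ) + 1 - k) + ((n : ℤ) - p) * p) := by
  obtain ⟨m, rfl⟩ := Nat.exists_eq_add_of_le hpn
  have h := core p m k hp hk
  have hpz : qint p ≠ 0 := by
    obtain ⟨a, rfl⟩ : ∃ a, p = a + 1 := ⟨p - 1, by omega⟩
    exact qint_ne a
  have hkz : qint k ≠ 0 := by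
    obtain ⟨a, rfl⟩ : ∃ a, k = a + 1 := ⟨k - 1, by omega⟩
    exact qint_ne a
  rw [← qint_eq, ← qint_eq] at h
  unfold gchoose
  have e : ((p + m : ℕ) : ℤ) - p = m := by push_cast; ring
  simp only [e]
  simp only [zpow_add₀ q_ne_zero ((m : ℤ) * p)]
  simp only [zpow_add₀ q_ne_zero _ ((m : ℤ) * p)]
  simp only [mul_comm (q ^ ((m : ℤ) * p)), ← mul_assoc]
  rw [← Finset.sum_mul, ← Finset.sum_mul]
  push_cast
  rw [← mul_assoc, ← mul_assoc]
  congr 1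
  rw [div_mul_eq_mul_div, div_mul_eq_mul_div, div_eq_div_iff hkz hpz]
  linear_combination qint (p + m) * h
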